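/- arXiv:2303.05237 — 2 statements merged into one kernel-verified Lean document; each statement's English description precedes it below -/
import Mathlib

section
/- Let p ≥ ℓ be real numbers and let (A_N), (B_N) be real sequences with A_N/N² → A₂ ∈ ℝ and B_N/N → B₁ > 0. If −A₂/B₁² < (ℓ + p)/2, then lim_{N→∞} I_{p,ℓ}(A_N, B_N) · e^{−f_N(p)} = 1, where f_N(k) = k A_N + k² B_N²/2. -/
open MeasureTheory Real Filter

/-- The standard Gaussian density `φ(v) = e^{-v²/2}/√(2π)` on `ℝ`. -/
noncomputable def gaussPDF (v : ℝ) : ℝ := Real.exp (-v ^ 2 / 2) / Real.sqrt (2 * Real.pi)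

/-- `I_{p,ℓ}(A,B) = ∫_ℝ φ(v) (1 + e^{A+Bv})^{p-ℓ} e^{ℓ(A+Bv)} dv`. -/
noncomputable def Iint (p ℓ A B : ℝ) : ℝ :=
  ∫ v : ℝ, gaussPDF v * (1 + Real.exp (A + B * v)) ^ (p - ℓ) * Real.exp (ℓ * (A + B * v))

/-- `f_N(k) = k A_N + k² B_N²/2`. -/
noncomputable def fExp (A B k : ℝ) : ℝ := k * A + k ^ 2 * B ^ 2 / 2

open ProbabilityTheory in
lemma gaussPDF_eq_aux (v : ℝ) : gaussPDF v = gaussianPDFReal 0 1 v := by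
  simp [gaussPDF, gaussianPDFReal]
  ring_nf

open ProbabilityTheory in
lemma Iint_shift_aux (p ℓ A B : ℝ) :
    Iint p ℓ A B * Real.exp (-(fExp A B p)) =
      ∫ w, (1 + Real.exp (-(A + p * B ^ 2 + B * w))) ^ (p - ℓ) ∂(gaussianReal 0 1) := by
  rw [integral_gaussianReal_eq_integral_smul one_ne_zero, Iint,
    ← integral_add_right_eq_self _ (p * B), ← integral_mul_const]
  congr 1
  ext w
  rw [← gaussPDF_eq_aux, smul_eq_mul]
  have hx : A + B * (w + p * B) = A + p * B ^ 2 + B * w := by ring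
  rw [hx]
  have h : (1 + Real.exp (A + p * B ^ 2 + B * w)) =
      Real.exp (A + p * B ^ 2 + B * w) * (1 + Real.exp (-(A + p * B ^ 2 + B * w))) := by
    rw [mul_add, ← Real.exp_add, add_neg_cancel, Real.exp_zero, mul_one, add_comm]
  rw [h, Real.mul_rpow (Real.exp_pos _).le (by positivity), ← Real.exp_mul]
  have h2 : gaussPDF (w + p * B) * (Real.exp ((A + p * B ^ 2 + B * w) * (p - ℓ)) *
      Real.exp (ℓ * (A + p * B ^ 2 + B * w)) * Real.exp (-fExp A B p)) = gaussPDF w := by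
    rw [← Real.exp_add, ← Real.exp_add, gaussPDF, gaussPDF, div_mul_eq_mul_div, ← Real.exp_add]
    congr 2
    rw [fExp]; ring
  rw [← h2]; ring

lemma F_le_aux (q x : ℝ) (hq : 0 ≤ q) :
    (1 + Real.exp (-x)) ^ q ≤ min ((1 + Real.exp (-x)) ^ q) (2 ^ q) + 2 ^ q * Real.exp (-q * x) := by
  rcases le_total 0 x with hx | hx
  · have : (1 + Real.exp (-x)) ^ q ≤ 2 ^ q := by
      apply Real.rpow_le_rpow (by positivity) _ hq
      have : Real.exp (-x) ≤ 1 := Real.exp_le_one_iff.2 (by linarith)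
      linarith
    rw [min_eq_left this]
    have : 0 ≤ (2:ℝ) ^ q * Real.exp (-q * x) := by positivity
    linarith
  · have h : (1 + Real.exp (-x)) ^ q ≤ (2 * Real.exp (-x)) ^ q := by
      apply Real.rpow_le_rpow (by positivity) _ hq
      have : 1 ≤ Real.exp (-x) := Real.one_le_exp (by linarith)
      linarith
    rw [Real.mul_rpow (by norm_num) (Real.exp_pos _).le, ← Real.exp_mul] at h
    have h3 : -x * q = -q * x := by ring
    rw [h3] at h
    have : 0 ≤ min ((1 + Real.exp (-x)) ^ q) ((2:ℝ) ^ q) := by positivity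
    linarith

lemma one_le_F_aux (q x : ℝ) (hq : 0 ≤ q) : 1 ≤ (1 + Real.exp (-x)) ^ q :=
  Real.one_le_rpow (by linarith [Real.exp_pos (-x)]) hq

open ProbabilityTheory in
lemma bounds_aux (q a b : ℝ) (hq : 0 ≤ q) :
    1 ≤ ∫ w, (1 + Real.exp (-(a + b * w))) ^ q ∂(gaussianReal 0 1) ∧
    ∫ w, (1 + Real.exp (-(a + b * w))) ^ q ∂(gaussianReal 0 1) ≤
      ∫ w, min ((1 + Real.exp (-(a + b * w))) ^ q) (2 ^ q) ∂(gaussianReal 0 1)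
        + 2 ^ q * Real.exp (-q * a + q ^ 2 * b ^ 2 / 2) := by
  have hm : Measurable fun w : ℝ => (1 + Real.exp (-(a + b * w))) ^ q := by fun_prop
  have hE : ∀ w : ℝ, Real.exp (-q * (a + b * w)) =
      Real.exp (-q * a) * Real.exp ((-q * b) * w) := by
    intro w; rw [← Real.exp_add]; ring_nf
  have hi2 : Integrable (fun w : ℝ => 2 ^ q * Real.exp (-q * (a + b * w)))
      (gaussianReal 0 1) := by
    simp_rw [hE]
    exact ((integrable_exp_mul_gaussianReal _).const_mul _).const_mul _
  have hi1 : Integrable (fun w : ℝ => min ((1 + Real.exp (-(a + b * w))) ^ q) ((2:ℝ) ^ q))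
      (gaussianReal 0 1) := by
    refine Integrable.of_bound (C := (2:ℝ) ^ q) (hm.min measurable_const).aestronglyMeasurable ?_
    refine ae_of_all _ fun w => ?_
    rw [Real.norm_of_nonneg (by positivity)]
    exact min_le_right _ _
  have hF : Integrable (fun w : ℝ => (1 + Real.exp (-(a + b * w))) ^ q) (gaussianReal 0 1) := by
    refine (hi1.add hi2).mono' hm.aestronglyMeasurable (ae_of_all _ fun w => ?_)
    rw [Real.norm_of_nonneg (by positivity)]
    exact F_le_aux q _ hq
  constructor
  · have := integral_mono (μ := gaussianReal 0 1) (integrable_const (1:ℝ)) hF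
      (fun w => one_le_F_aux q _ hq)
    simpa using this
  · have h := integral_mono hF (hi1.add hi2) (fun w => F_le_aux q _ hq)
    have h2 : ∫ w, 2 ^ q * Real.exp (-q * (a + b * w)) ∂(gaussianReal 0 1) =
        2 ^ q * Real.exp (-q * a + q ^ 2 * b ^ 2 / 2) := by
      simp_rw [hE]
      rw [integral_const_mul, integral_const_mul]
      have h3 := congrFun (mgf_id_gaussianReal (μ := 0) (v := 1)) (-q * b)
      simp only [mgf, id] at h3
      rw [h3, ← Real.exp_add]
      congr 2
      simp; ring
    rw [← h2, ← integral_add hi1 hi2]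
    exact h

/-- First case of the `p ≥ ℓ` branch of Proposition S1: for `-A₂/B₁² < (ℓ+p)/2`,
`I_{p,ℓ}(A_N, B_N) ≈ e^{f_N(p)}` at leading order. -/
theorem Iint_asymptotics_pge_p (p ℓ A₂ B₁ : ℝ) (hpl : p ≥ ℓ) (A B : ℕ → ℝ)
    (hA : Tendsto (fun N : ℕ => A N / (N : ℝ) ^ 2) atTop (nhds A₂))
    (hB : Tendsto (fun N : ℕ => B N / (N : ℝ)) atTop (nhds B₁))
    (hB₁ : 0 < B₁) (h1 : -A₂ / B₁ ^ 2 < (ℓ + p) / 2) :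
    Tendsto (fun N : ℕ => Iint p ℓ (A N) (B N) * Real.exp (-(fExp (A N) (B N) p)))
      atTop (nhds 1) := by
  have hq : 0 ≤ p - ℓ := by linarith
  simp_rw [Iint_shift_aux]
  rcases hq.eq_or_lt with hq0 | hqpos
  · simp [← hq0]
  have hN : Tendsto (fun N : ℕ => (N : ℝ)) atTop atTop := tendsto_natCast_atTop_atTop
  have hN2 : Tendsto (fun N : ℕ => (N : ℝ) ^ 2) atTop atTop :=
    (tendsto_pow_atTop (two_ne_zero)).comp hN
  have hNi : Tendsto (fun N : ℕ => (N : ℝ)⁻¹) atTop (nhds 0) := tendsto_inv_atTop_zero.comp hN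
  have hpos : 0 < A₂ + (ℓ + p) / 2 * B₁ ^ 2 := by
    rw [div_lt_iff₀ (by positivity)] at h1
    linarith
  have hpos2 : 0 < A₂ + p * B₁ ^ 2 := by nlinarith [sq_pos_of_pos hB₁]
  have hx : ∀ w : ℝ, Tendsto (fun N : ℕ => A N + p * B N ^ 2 + B N * w) atTop atTop := by
    intro w
    have h : Tendsto (fun N : ℕ => A N / (N:ℝ) ^ 2 + p * (B N / N) ^ 2 + (B N / N) * (N:ℝ)⁻¹ * w)
        atTop (nhds (A₂ + p * B₁ ^ 2 + B₁ * 0 * w)) :=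
      (hA.add ((hB.pow 2).const_mul p)).add ((hB.mul hNi).mul_const w)
    rw [mul_zero, zero_mul, add_zero] at h
    refine (h.pos_mul_atTop hpos2 hN2).congr' ?_
    filter_upwards [eventually_ne_atTop 0] with N hN0
    have : (N:ℝ) ≠ 0 := by exact_mod_cast hN0
    field_simp
  have hE : Tendsto (fun N : ℕ => Real.exp (-(p - ℓ) * (A N + p * B N ^ 2) +
      (p - ℓ) ^ 2 * B N ^ 2 / 2)) atTop (nhds 0) := by
    refine Real.tendsto_exp_atBot.comp ?_
    have h : Tendsto (fun N : ℕ => -(p - ℓ) * (A N / (N:ℝ) ^ 2 + p * (B N / N) ^ 2) +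
      (p - ℓ) ^ 2 * (B N / N) ^ 2 / 2) atTop (nhds (-(p - ℓ) * (A₂ + p * B₁ ^ 2) +
      (p - ℓ) ^ 2 * B₁ ^ 2 / 2)) :=
      ((hA.add ((hB.pow 2).const_mul p)).const_mul _).add (((hB.pow 2).const_mul _).div_const 2)
    have hneg : -(p - ℓ) * (A₂ + p * B₁ ^ 2) + (p - ℓ) ^ 2 * B₁ ^ 2 / 2 < 0 := by
      nlinarith [mul_pos hqpos hpos]
    refine (h.neg_mul_atTop hneg hN2).congr' ?_
    filter_upwards [eventually_ne_atTop 0] with N hN0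
    have : (N:ℝ) ≠ 0 := by exact_mod_cast hN0
    field_simp
  have hD : Tendsto (fun N : ℕ => ∫ w, min ((1 + Real.exp (-(A N + p * B N ^ 2 + B N * w))) ^ (p - ℓ))
      ((2:ℝ) ^ (p - ℓ)) ∂(ProbabilityTheory.gaussianReal 0 1)) atTop (nhds 1) := by
    have h1' : nhds (1:ℝ) = nhds (∫ w : ℝ, (1:ℝ) ∂(ProbabilityTheory.gaussianReal 0 1)) := by simp
    refine (show Tendsto _ _ (nhds (∫ w : ℝ, (1:ℝ) ∂(ProbabilityTheory.gaussianReal 0 1))) from ?_).trans h1'.ge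
    refine tendsto_integral_of_dominated_convergence (fun _ => (2:ℝ) ^ (p - ℓ)) ?_
      (integrable_const _) ?_ ?_
    · intro N
      exact Measurable.aestronglyMeasurable (by fun_prop)
    · intro N
      refine ae_of_all _ fun w => ?_
      rw [Real.norm_of_nonneg (by positivity)]
      exact min_le_right _ _
    · refine ae_of_all _ fun w => ?_
      have h3 : Tendsto (fun N : ℕ => 1 + Real.exp (-(A N + p * B N ^ 2 + B N * w))) atTop
          (nhds (1 + 0)) :=
        (Real.tendsto_exp_neg_atTop_nhds_zero.comp (hx w)).const_add 1
      have h4 := (h3.rpow_const (p := p - ℓ) (Or.inr hq)).min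
        (tendsto_const_nhds (x := (2:ℝ) ^ (p - ℓ)))
      rw [add_zero, Real.one_rpow, min_eq_left (Real.one_le_rpow (by norm_num) hq)] at h4
      exact h4
  have hU := hD.add (hE.const_mul ((2:ℝ) ^ (p - ℓ)))
  rw [mul_zero, add_zero] at hU
  exact tendsto_of_tendsto_of_tendsto_of_le_of_le tendsto_const_nhds hU
    (fun N => (bounds_aux (p - ℓ) (A N + p * B N ^ 2) (B N) hq).1)
    (fun N => (bounds_aux (p - ℓ) (A N + p * B N ^ 2) (B N) hq).2)
end

section
/- Let p > 1 be real and let (A_N), (B_N) be real sequences with A_N/N² → A₂ ∈ ℝ and B_N/N → B₁ > 0. If 1 < −A₂/B₁² < p, then lim_{N→∞} J_p(A_N, B_N) / ( e^{f_N(1)} + (A_N + p B_N²) e^{f_N(p)} ) = 1, where f_N(k) = k A_N + k² B_N²/2. -/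
open MeasureTheory Real Filter

/-- `J_p(A,B) = ∫_ℝ φ(v) (1 + e^{A+Bv})^p log(1 + e^{A+Bv}) dv`. -/
noncomputable def Jint (p A B : ℝ) : ℝ :=
  ∫ v : ℝ, gaussPDF v * (1 + Real.exp (A + B * v)) ^ p * Real.log (1 + Real.exp (A + B * v))

lemma gaussPDF_eq (v : ℝ) : gaussPDF v = ProbabilityTheory.gaussianPDFReal 0 1 v := by
  simp only [gaussPDF, ProbabilityTheory.gaussianPDFReal, NNReal.coe_one, mul_one, sub_zero]
  rw [div_eq_inv_mul]

lemma gaussPDF_integrable : Integrable gaussPDF := by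
  rw [show gaussPDF = ProbabilityTheory.gaussianPDFReal 0 1 from funext gaussPDF_eq]
  exact ProbabilityTheory.integrable_gaussianPDFReal 0 1

lemma gaussPDF_integral : ∫ v, gaussPDF v = 1 := by
  rw [show gaussPDF = ProbabilityTheory.gaussianPDFReal 0 1 from funext gaussPDF_eq]
  exact ProbabilityTheory.integral_gaussianPDFReal_eq_one 0 one_ne_zero

lemma gaussPDF_nonneg (v : ℝ) : 0 ≤ gaussPDF v := by
  unfold gaussPDF; positivity

lemma gaussPDF_continuous : Continuous gaussPDF := by
  unfold gaussPDF; fun_prop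

lemma mul_gaussPDF_integrable : Integrable (fun v => v * gaussPDF v) := by
  have h := (integrable_mul_exp_neg_mul_sq (b := 1 / 2) (by norm_num)).div_const (√(2 * π))
  refine h.congr (Eventually.of_forall fun v => ?_)
  simp only [gaussPDF]
  rw [mul_div_assoc]
  congr 3
  ring

lemma mul_gaussPDF_integral : ∫ v, v * gaussPDF v = 0 := by
  have h := integral_neg_eq_self (fun v : ℝ => v * gaussPDF v) volume
  have h2 : ∀ v : ℝ, (-v) * gaussPDF (-v) = -(v * gaussPDF v) := by
    intro v; simp [gaussPDF]
  simp only [h2, integral_neg] at h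
  linarith

lemma gauss_shift (A B k v : ℝ) :
    gaussPDF v * exp (k * (A + B * v)) = exp (fExp A B k) * gaussPDF (v - k * B) := by
  simp only [gaussPDF, fExp]
  rw [div_mul_eq_mul_div, ← exp_add, mul_div_assoc', ← exp_add]
  congr 2
  ring

lemma gauss_exp_integrable (A B k : ℝ) :
    Integrable (fun v => gaussPDF v * exp (k * (A + B * v))) := by
  simp only [gauss_shift]
  exact (gaussPDF_integrable.comp_sub_right (k * B)).const_mul _

lemma gauss_exp_integral (A B k : ℝ) :
    ∫ v, gaussPDF v * exp (k * (A + B * v)) = exp (fExp A B k) := by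
  simp only [gauss_shift]
  rw [integral_const_mul, integral_sub_right_eq_self gaussPDF, gaussPDF_integral, mul_one]

lemma gauss_lin_eq (A B k v : ℝ) :
    gaussPDF v * ((A + B * v) * exp (k * (A + B * v))) =
      (fun w => exp (fExp A B k) * ((A + k * B ^ 2) * gaussPDF w + B * (w * gaussPDF w)))
        (v - k * B) := by
  have := gauss_shift A B k v
  simp only
  linear_combination (A + B * v) * this

lemma gauss_lin_integrable (A B k : ℝ) :
    Integrable (fun v => gaussPDF v * ((A + B * v) * exp (k * (A + B * v)))) := by
  simp only [gauss_lin_eq]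
  exact (((gaussPDF_integrable.const_mul _).add
    (mul_gaussPDF_integrable.const_mul _)).const_mul _).comp_sub_right (k * B)

lemma gauss_lin_integral (A B k : ℝ) :
    ∫ v, gaussPDF v * ((A + B * v) * exp (k * (A + B * v))) =
      (A + k * B ^ 2) * exp (fExp A B k) := by
  simp only [gauss_lin_eq]
  rw [integral_sub_right_eq_self (fun w => exp (fExp A B k) *
    ((A + k * B ^ 2) * gaussPDF w + B * (w * gaussPDF w)))]
  rw [integral_const_mul, integral_add (gaussPDF_integrable.const_mul _)
    (mul_gaussPDF_integrable.const_mul _), integral_const_mul, integral_const_mul,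
    gaussPDF_integral, mul_gaussPDF_integral]
  ring

lemma rpow_bound (p t : ℝ) (hp : 1 ≤ p) (h0 : 0 ≤ t) (h1 : t ≤ 1) :
    1 ≤ (1 + t) ^ p ∧ (1 + t) ^ p ≤ 1 + 2 ^ p * t := by
  refine ⟨Real.one_le_rpow (by linarith) (by linarith), ?_⟩
  have h := (convexOn_rpow hp).2 (show (1 : ℝ) ∈ Set.Ici 0 by simp)
    (show (2 : ℝ) ∈ Set.Ici 0 by simp) (show 0 ≤ 1 - t by linarith) h0 (by ring)
  simp only [smul_eq_mul, one_rpow] at h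
  rw [show (1 - t) * 1 + t * 2 = 1 + t by ring] at h
  linarith

lemma log_bound (t : ℝ) (h0 : 0 ≤ t) : t - t ^ 2 ≤ log (1 + t) ∧ log (1 + t) ≤ t := by
  constructor
  · have h := one_sub_inv_le_log_of_pos (show 0 < 1 + t by linarith)
    refine le_trans ?_ h
    have : (1 + t)⁻¹ ≤ 1 - t + t ^ 2 := by
      rw [inv_le_iff_one_le_mul₀ (by linarith)]
      nlinarith [pow_nonneg h0 3]
    linarith
  · have := log_le_sub_one_of_pos (show 0 < 1 + t by linarith)
    linarith

lemma ptwise (p ε : ℝ) (hp : 1 < p) (hε : 0 < ε) (hε1 : ε ≤ 1 / 2) (x : ℝ) :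
    |(1 + exp x) ^ p * log (1 + exp x) - exp x - x * exp (p * x)| ≤
      (3 * 2 ^ p + 2 + 1 / ε) * (exp ((p - ε) * x) + exp ((1 + ε) * x)) := by
  have hM : (0 : ℝ) < 2 ^ p := by positivity
  set M : ℝ := 2 ^ p with hMdef
  have hie : 0 < 1 / ε := by positivity
  have e1 := exp_pos ((p - ε) * x)
  have e2 := exp_pos ((1 + ε) * x)
  rcases le_total 0 x with hx | hx
  · set t := exp (-x) with ht
    have ht0 : 0 < t := exp_pos _
    have ht1 : t ≤ 1 := by rw [ht]; exact exp_le_one_iff.2 (by linarith)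
    obtain ⟨hR1, hR2⟩ := rpow_bound p t hp.le ht0.le ht1
    obtain ⟨-, hl2⟩ := log_bound t ht0.le
    have hl0 : 0 ≤ log (1 + t) := log_nonneg (by linarith)
    have hfac : 1 + exp x = exp x * (1 + t) := by
      rw [mul_add, ht, ← exp_add]; simp [add_comm]
    have hpow : (1 + exp x) ^ p = exp (p * x) * (1 + t) ^ p := by
      rw [hfac, mul_rpow (exp_pos _).le (by linarith), ← exp_mul, mul_comm x p]
    have hlog : log (1 + exp x) = x + log (1 + t) := by
      rw [hfac, log_mul (exp_pos _).ne' (by linarith), log_exp]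
    rw [hpow, hlog]
    set R := (1 + t) ^ p
    set l := log (1 + t)
    have hE := exp_pos (p * x)
    have hEt : exp (p * x) * t = exp ((p - 1) * x) := by
      rw [ht, ← exp_add]; congr 1; ring
    have hb1 : exp ((p - 1) * x) ≤ exp ((p - ε) * x) := exp_le_exp.2 (by nlinarith)
    have hb2 : x * exp ((p - 1) * x) ≤ 2 * exp ((p - ε) * x) := by
      have h3 : x ≤ 2 * exp (x / 2) := by have := add_one_le_exp (x / 2); linarith
      calc x * exp ((p - 1) * x) ≤ 2 * exp (x / 2) * exp ((p - 1) * x) := by gcongr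
        _ = 2 * exp (x / 2 + (p - 1) * x) := by rw [exp_add]; ring
        _ ≤ 2 * exp ((p - ε) * x) := by gcongr; nlinarith
    have hb3 : exp x ≤ exp ((1 + ε) * x) := exp_le_exp.2 (by nlinarith)
    have hx0 := exp_pos x
    have hD0 : 0 ≤ exp (p * x) * ((R - 1) * x + R * l) := by
      have : 0 ≤ R - 1 := by linarith
      have : 0 ≤ R := by linarith
      positivity
    have hD1 : exp (p * x) * ((R - 1) * x + R * l) ≤ (3 * M + 1) * exp ((p - ε) * x) := by
      have h4 : (R - 1) * x ≤ M * t * x := by gcongr; linarith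
      have h5 : R * l ≤ (1 + M) * t := by
        have : R ≤ 1 + M := by nlinarith
        gcongr
      calc exp (p * x) * ((R - 1) * x + R * l) ≤ exp (p * x) * (M * t * x + (1 + M) * t) := by
            gcongr
        _ = M * (x * exp ((p - 1) * x)) + (1 + M) * exp ((p - 1) * x) := by rw [← hEt]; ring
        _ ≤ M * (2 * exp ((p - ε) * x)) + (1 + M) * exp ((p - ε) * x) := by gcongr
        _ = _ := by ring
    have hid : exp (p * x) * R * (x + l) - exp x - x * exp (p * x) =
      exp (p * x) * ((R - 1) * x + R * l) - exp x := by ring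
    rw [hid, abs_le]
    have q1 : 0 < (3 * M) * exp ((p - ε) * x) := by positivity
    have q2 : 0 < (3 * M) * exp ((1 + ε) * x) := by positivity
    have q3 : 0 < (1 / ε) * exp ((p - ε) * x) := by positivity
    have q4 : 0 < (1 / ε) * exp ((1 + ε) * x) := by positivity
    constructor <;> linarith
  · set t := exp x with ht
    have ht0 : 0 < t := exp_pos _
    have ht1 : t ≤ 1 := by rw [ht]; exact exp_le_one_iff.2 (by linarith)
    obtain ⟨hR1, hR2⟩ := rpow_bound p t hp.le ht0.le ht1
    obtain ⟨hl1, hl2⟩ := log_bound t ht0.le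
    have hl0 : 0 ≤ log (1 + t) := log_nonneg (by linarith)
    set R := (1 + t) ^ p
    set l := log (1 + t)
    have ht2 : t ^ 2 ≤ exp ((1 + ε) * x) := by
      rw [ht, ← exp_nat_mul]; apply exp_le_exp.2; push_cast; nlinarith
    have hxe : -x * exp (p * x) ≤ (1 / ε) * exp ((p - ε) * x) := by
      have h3 : -x ≤ (1 / ε) * exp (-ε * x) := by
        have := add_one_le_exp (-ε * x)
        rw [one_div, ← div_eq_inv_mul, le_div_iff₀ hε]
        linarith
      calc -x * exp (p * x) ≤ (1 / ε) * exp (-ε * x) * exp (p * x) := by gcongr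
        _ = _ := by rw [mul_assoc, ← exp_add]; congr 2; ring
    have hxe0 : 0 ≤ -x * exp (p * x) := mul_nonneg (by linarith) (exp_pos _).le
    have hlow : -t ^ 2 ≤ R * l - t := by nlinarith
    have hup : R * l - t ≤ M * t ^ 2 := by
      have : R * l ≤ (1 + M * t) * t := by gcongr
      nlinarith
    have hup2 : M * t ^ 2 ≤ M * exp ((1 + ε) * x) := by gcongr
    rw [abs_le]
    have q1 : 0 < M * exp ((p - ε) * x) := by positivity
    have q2 : 0 < M * exp ((1 + ε) * x) := by positivity
    have q3 : 0 < (1 / ε) * exp ((p - ε) * x) := by positivity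
    have q4 : 0 < (1 / ε) * exp ((1 + ε) * x) := by positivity
    constructor <;> linarith

lemma fExp_bound (A B p k : ℝ) (h1 : 1 ≤ k) (h2 : k ≤ p) (hp : 1 < p) :
    exp (fExp A B k) ≤ exp (-((k - 1) * (p - k) / 2 * B ^ 2)) *
      (exp (fExp A B 1) + exp (fExp A B p)) := by
  have key : (p - 1) * (fExp A B k + (k - 1) * (p - k) / 2 * B ^ 2) =
      (p - k) * fExp A B 1 + (k - 1) * fExp A B p := by
    simp only [fExp]; ring
  have e1 := exp_pos (fExp A B 1)
  have e2 := exp_pos (fExp A B p)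
  have hmax : fExp A B k + (k - 1) * (p - k) / 2 * B ^ 2 ≤ max (fExp A B 1) (fExp A B p) := by
    have m1 := le_max_left (fExp A B 1) (fExp A B p)
    have m2 := le_max_right (fExp A B 1) (fExp A B p)
    have : 0 < p - 1 := by linarith
    refine le_of_mul_le_mul_left ?_ this
    rw [key]
    nlinarith
  have h3 : exp (max (fExp A B 1) (fExp A B p)) ≤ exp (fExp A B 1) + exp (fExp A B p) := by
    rcases max_choice (fExp A B 1) (fExp A B p) with h | h <;> rw [h] <;> linarith
  calc exp (fExp A B k) = exp (-((k - 1) * (p - k) / 2 * B ^ 2)) *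
        exp (fExp A B k + (k - 1) * (p - k) / 2 * B ^ 2) := by
        rw [← exp_add]; congr 1; ring
    _ ≤ _ := by
        gcongr
        exact (exp_le_exp.2 hmax).trans h3

lemma Jint_bound (p ε A B : ℝ) (hp : 1 < p) (hε : 0 < ε) (hε1 : ε ≤ 1 / 2) :
    |Jint p A B - (exp (fExp A B 1) + (A + p * B ^ 2) * exp (fExp A B p))| ≤
      (3 * 2 ^ p + 2 + 1 / ε) * (exp (fExp A B (p - ε)) + exp (fExp A B (1 + ε))) := by
  set C : ℝ := 3 * 2 ^ p + 2 + 1 / ε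
  let G : ℝ → ℝ := fun v => gaussPDF v * (1 + exp (A + B * v)) ^ p * log (1 + exp (A + B * v))
  let H : ℝ → ℝ := fun v => gaussPDF v * exp (1 * (A + B * v)) +
    gaussPDF v * ((A + B * v) * exp (p * (A + B * v)))
  let E : ℝ → ℝ := fun v => C * (gaussPDF v * exp ((p - ε) * (A + B * v)) +
    gaussPDF v * exp ((1 + ε) * (A + B * v)))
  have hH : Integrable H := (gauss_exp_integrable A B 1).add (gauss_lin_integrable A B p)
  have hE : Integrable E :=
    ((gauss_exp_integrable A B _).add (gauss_exp_integrable A B _)).const_mul C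
  have hle : ∀ v, ‖G v - H v‖ ≤ E v := by
    intro v
    have h := mul_le_mul_of_nonneg_left (ptwise p ε hp hε hε1 (A + B * v)) (gaussPDF_nonneg v)
    rw [← abs_of_nonneg (gaussPDF_nonneg v), ← abs_mul, abs_of_nonneg (gaussPDF_nonneg v)] at h
    rw [Real.norm_eq_abs]
    have i1 : G v - H v = gaussPDF v * ((1 + exp (A + B * v)) ^ p * log (1 + exp (A + B * v)) -
        exp (A + B * v) - (A + B * v) * exp (p * (A + B * v))) := by
      simp only [G, H, one_mul]; ring
    have i2 : E v = gaussPDF v * ((3 * 2 ^ p + 2 + 1 / ε) *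
        (exp ((p - ε) * (A + B * v)) + exp ((1 + ε) * (A + B * v)))) := by
      simp only [E, C]; ring
    rw [i1, i2]
    exact h
  have hGc : Continuous G := by
    have hc : Continuous fun v : ℝ => 1 + exp (A + B * v) := by fun_prop
    have hpos : ∀ v : ℝ, 1 + exp (A + B * v) ≠ 0 := fun v => by positivity
    exact (gaussPDF_continuous.mul (hc.rpow_const fun v => Or.inl (hpos v))).mul (hc.log hpos)
  have hHc : Continuous H := by
    have := gaussPDF_continuous
    simp only [H]; fun_prop
  have hGH : Integrable (fun v => G v - H v) :=
    hE.mono' (hGc.sub hHc).aestronglyMeasurable (Eventually.of_forall hle)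
  have hG : Integrable G := by
    refine (hGH.add hH).congr (Eventually.of_forall fun v => ?_)
    simp
  have hJ : Jint p A B = ∫ v, G v := rfl
  have hHi : ∫ v, H v = exp (fExp A B 1) + (A + p * B ^ 2) * exp (fExp A B p) := by
    simp only [H]
    rw [integral_add (gauss_exp_integrable A B 1) (gauss_lin_integrable A B p),
      gauss_exp_integral, gauss_lin_integral]
  have hEi : ∫ v, E v = C * (exp (fExp A B (p - ε)) + exp (fExp A B (1 + ε))) := by
    simp only [E]
    rw [integral_const_mul, integral_add (gauss_exp_integrable A B _) (gauss_exp_integrable A B _),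
      gauss_exp_integral, gauss_exp_integral]
  rw [hJ, ← hHi, ← hEi, ← integral_sub hG hH, ← Real.norm_eq_abs]
  exact norm_integral_le_of_norm_le hE (Eventually.of_forall hle)

/-- Middle case of the `p ≥ 1` branch of Proposition S2: for `p > 1` and
`1 < -A₂/B₁² < p`, `J_p(A_N, B_N) ≈ e^{f_N(1)} + (A_N + p B_N²) e^{f_N(p)}`. -/
theorem Jint_asymptotics_middle (p A₂ B₁ : ℝ) (hp : 1 < p) (A B : ℕ → ℝ)
    (hA : Tendsto (fun N : ℕ => A N / (N : ℝ) ^ 2) atTop (nhds A₂))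
    (hB : Tendsto (fun N : ℕ => B N / (N : ℝ)) atTop (nhds B₁))
    (hB₁ : 0 < B₁) (h1 : 1 < -A₂ / B₁ ^ 2) (h2 : -A₂ / B₁ ^ 2 < p) :
    Tendsto (fun N : ℕ => Jint p (A N) (B N)
        / (Real.exp (fExp (A N) (B N) 1)
            + (A N + p * (B N) ^ 2) * Real.exp (fExp (A N) (B N) p))) atTop (nhds 1) := by
  have hN2 : Tendsto (fun N : ℕ => (N : ℝ) ^ 2) atTop atTop :=
    (tendsto_pow_atTop two_ne_zero).comp tendsto_natCast_atTop_atTop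
  have hB2 : Tendsto (fun N : ℕ => (B N) ^ 2) atTop atTop := by
    have h := (hB.pow 2).pos_mul_atTop (by positivity) hN2
    refine h.congr' ?_
    filter_upwards [eventually_gt_atTop 0] with N hN
    have : (N : ℝ) ≠ 0 := by positivity
    field_simp
  have hAB : Tendsto (fun N : ℕ => A N + p * (B N) ^ 2) atTop atTop := by
    have hpos : 0 < A₂ + p * B₁ ^ 2 := by
      rw [div_lt_iff₀ (by positivity)] at h2
      linarith
    have h := (hA.add ((hB.pow 2).const_mul p)).pos_mul_atTop hpos hN2
    refine h.congr' ?_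
    filter_upwards [eventually_gt_atTop 0] with N hN
    have : (N : ℝ) ≠ 0 := by positivity
    field_simp
  obtain ⟨ε, hε, hε1, hε2⟩ : ∃ ε : ℝ, 0 < ε ∧ ε ≤ 1 / 2 ∧ ε < p - 1 := by
    refine ⟨min (1 / 2) ((p - 1) / 2), lt_min (by norm_num) (by linarith), min_le_left _ _, ?_⟩
    exact (min_le_right _ _).trans_lt (by linarith)
  set C : ℝ := 3 * 2 ^ p + 2 + 1 / ε with hC
  have hC0 : 0 < C := by positivity
  set c : ℝ := ε * (p - 1 - ε) / 2 with hc
  have hc0 : 0 < c := by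
    have : 0 < p - 1 - ε := by linarith
    positivity
  have hlim : Tendsto (fun N : ℕ => 2 * C * exp (-(c * (B N) ^ 2))) atTop (nhds 0) := by
    have := (tendsto_exp_neg_atTop_nhds_zero.comp (hB2.const_mul_atTop hc0)).const_mul (2 * C)
    simpa using this
  rw [tendsto_iff_norm_sub_tendsto_zero]
  refine squeeze_zero' (Eventually.of_forall fun N => norm_nonneg _) ?_ hlim
  filter_upwards [hAB.eventually_ge_atTop 1] with N hN
  have e1 := exp_pos (fExp (A N) (B N) 1)
  have e2 := exp_pos (fExp (A N) (B N) p)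
  have hJ := Jint_bound p ε (A N) (B N) hp hε hε1
  have b1 := fExp_bound (A N) (B N) p (p - ε) (by linarith) (by linarith) hp
  have b2 := fExp_bound (A N) (B N) p (1 + ε) (by linarith) (by linarith) hp
  rw [show (p - ε - 1) * (p - (p - ε)) / 2 = c by rw [hc]; ring] at b1
  rw [show (1 + ε - 1) * (p - (1 + ε)) / 2 = c by rw [hc]; ring] at b2
  set D := exp (fExp (A N) (B N) 1) + (A N + p * (B N) ^ 2) * exp (fExp (A N) (B N) p) with hD
  have hDge : exp (fExp (A N) (B N) 1) + exp (fExp (A N) (B N) p) ≤ D := by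
    rw [hD]; nlinarith
  have hD0 : 0 < D := by linarith
  rw [Real.norm_eq_abs, div_sub_one hD0.ne', abs_div, abs_of_pos hD0, div_le_iff₀ hD0]
  calc |Jint p (A N) (B N) - D| ≤ C * (exp (fExp (A N) (B N) (p - ε)) +
        exp (fExp (A N) (B N) (1 + ε))) := hJ
    _ ≤ C * (exp (-(c * (B N) ^ 2)) * D + exp (-(c * (B N) ^ 2)) * D) := by
        gcongr
        · exact b1.trans (by gcongr)
        · exact b2.trans (by gcongr)
    _ = _ := by ring
end
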